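/- Let D[X,Y] be a spine digraph and let k be a positive integer. Then π_k(D) ≤ α_k(D). (Linial's Conjecture holds for spine digraphs.) -/

import Mathlib

/-- `p` is a directed path in the digraph with arc relation `A`:
a list of pairwise distinct vertices with consecutive arcs. -/
def IsDipath {V : Type*} (A : V → V → Prop) (p : List V) : Prop :=
  p.Nodup ∧ p.Chain' A

/-- `u` and `v` are adjacent: there is an arc between them in some direction. -/
def DiAdj {V : Type*} (A : V → V → Prop) (u v : V) : Prop := A u v ∨ A v u

/-- A stable set: pairwise non-adjacent vertices. -/
def IsStableSet {V : Type*} (A : V → V → Prop) (S : Set V) : Prop :=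
  ∀ u ∈ S, ∀ v ∈ S, u ≠ v → ¬ DiAdj A u v

/-- A path partition of the digraph: a family of nonempty vertex-disjoint
directed paths covering all vertices. -/
def IsPathPartition {V : Type*} (A : V → V → Prop) (Part : Finset (List V)) : Prop :=
  (∀ p ∈ Part, IsDipath A p ∧ p ≠ []) ∧
  (∀ p ∈ Part, ∀ q ∈ Part, p ≠ q → ∀ v : V, v ∈ p → v ∉ q) ∧
  (∀ v : V, ∃ p ∈ Part, v ∈ p)

/-- The `k`-norm of a path partition: `∑_{P ∈ Part} min (|P|, k)`. -/
def kNorm {V : Type*} (k : ℕ) (Part : Finset (List V)) : ℕ :=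
  ∑ p ∈ Part, min p.length k

/-- `π_k(D)`: the minimum `k`-norm of a path partition. -/
noncomputable def piK {V : Type*} (A : V → V → Prop) (k : ℕ) : ℕ :=
  sInf {n | ∃ Part : Finset (List V), IsPathPartition A Part ∧ kNorm k Part = n}

/-- A `k`-partial coloring: `k` pairwise disjoint stable color classes
(possibly empty). -/
def IsKPartialColoring {V : Type*} (A : V → V → Prop) (k : ℕ) (C : Fin k → Finset V) : Prop :=
  (∀ i, IsStableSet A ((C i : Finset V) : Set V)) ∧
  ∀ i j, i ≠ j → Disjoint (C i) (C j)

/-- `α_k(D)`: the maximum weight (total size) of a `k`-partial coloring. -/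
noncomputable def alphaK {V : Type*} (A : V → V → Prop) (k : ℕ) : ℕ :=
  sSup {n | ∃ C : Fin k → Finset V, IsKPartialColoring A k C ∧ ∑ i, (C i).card = n}

/-- `{X, Y}` witnesses that the digraph is a spine digraph: `X` and `Y`
partition the vertex set, the subdigraph induced by `X` is traceable
(has a Hamiltonian directed path), and `Y` is stable. -/
def IsSpinePartition {V : Type*} (A : V → V → Prop) (X Y : Finset V) : Prop :=
  (∀ v : V, v ∈ X ↔ v ∉ Y) ∧
  (∃ p : List V, IsDipath A p ∧ ∀ v : V, v ∈ p ↔ v ∈ X) ∧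
  IsStableSet A (Y : Set V)

/-- A spine digraph `D[X,Y]` is `k`-loose if `|X| < k` or some `k`-subset `S` of
`X` is such that no `y ∈ Y` is adjacent to every vertex of `S`. -/
def IsKLoose {V : Type*} (A : V → V → Prop) (k : ℕ) (X Y : Finset V) : Prop :=
  X.card < k ∨ ∃ S ⊆ X, S.card = k ∧ ∀ y ∈ Y, ∃ x ∈ S, ¬ DiAdj A y x

/-- A Hamiltonian path `p` of `D[X]` is zigzag-free in `D` if no `y ∈ Y` has an
arc into the first vertex, no arc from the last vertex into `y`, and there is no
`i` with arcs `(p_i, y)` and `(y, p_{i+1})`. -/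
def ZigzagFree {V : Type*} (A : V → V → Prop) (Y : Finset V) (p : List V) : Prop :=
  ∀ y ∈ Y,
    (∀ h : p ≠ [], ¬ A y (p.head h)) ∧
    (∀ h : p ≠ [], ¬ A (p.getLast h) y) ∧
    (∀ i : ℕ, ∀ hi : i + 1 < p.length,
      ¬ (A (p.get ⟨i, Nat.lt_of_succ_lt hi⟩) y ∧ A y (p.get ⟨i + 1, hi⟩)))

/-- Every coloring has weight at most `α_k`. -/
theorem sum_card_le_alphaK {V : Type*} [Fintype V] {A : V → V → Prop} {k : ℕ}
    {C : Fin k → Finset V} (hC : IsKPartialColoring A k C) :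
    ∑ i, (C i).card ≤ alphaK A k := by
  refine le_csSup ⟨k * Fintype.card V, ?_⟩ ⟨C, hC, rfl⟩
  rintro n ⟨C', -, rfl⟩
  calc ∑ i, (C' i).card ≤ ∑ _i : Fin k, Fintype.card V :=
        Finset.sum_le_sum fun i _ => Finset.card_le_univ _
    _ = k * Fintype.card V := by simp

/-- If the vertices of `S` get distinct colors and each vertex of the stable set `Y` gets a color
not used by its neighbors in `S`, then `|S| + |Y| ≤ α_k`. -/
theorem card_add_card_le_alphaK {V : Type*} [Fintype V] [DecidableEq V] {A : V → V → Prop}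
    {k : ℕ} {S Y : Finset V} (hSY : Disjoint S Y) (hY : IsStableSet A (Y : Set V))
    (e g : V → Fin k) (he : Set.InjOn e S)
    (hg : ∀ y ∈ Y, ∀ s ∈ S, e s = g y → ¬ DiAdj A y s) :
    S.card + Y.card ≤ alphaK A k := by
  have hdis : ∀ i, Disjoint (S.filter (e · = i)) (Y.filter (g · = i)) := fun i =>
    Finset.disjoint_filter_filter hSY
  have hC : IsKPartialColoring A k
      (fun i => S.filter (e · = i) ∪ Y.filter (g · = i)) := by
    constructor
    · intro i u hu v hv huv hadj
      simp only [Finset.coe_union, Finset.coe_filter, Set.mem_union, Set.mem_ofPred_eq] at hu hv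
      rcases hu with ⟨hu, hui⟩ | ⟨hu, hui⟩ <;> rcases hv with ⟨hv, hvi⟩ | ⟨hv, hvi⟩
      · exact huv (he hu hv (hui.trans hvi.symm))
      · exact hg v hv u hu (hui.trans hvi.symm) hadj.symm
      · exact hg u hu v hv (hvi.trans hui.symm) hadj
      · exact hY u hu v hv huv hadj
    · intro i j hij
      rw [Finset.disjoint_left]
      intro v hi hj
      simp only [Finset.mem_union, Finset.mem_filter] at hi hj
      rw [Finset.disjoint_left] at hSY
      grind
  refine le_trans (le_of_eq ?_) (sum_card_le_alphaK hC)
  simp_rw [Finset.card_union_of_disjoint (hdis _)]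
  rw [Finset.sum_add_distrib,
    Finset.card_eq_sum_card_fiberwise (f := e) (t := Finset.univ) (fun _ _ => by simp),
    Finset.card_eq_sum_card_fiberwise (f := g) (s := Y) (t := Finset.univ) (fun _ _ => by simp)]

/-- A family of disjoint nonempty paths, completed by one-vertex paths, bounds `π_k` from above. -/
theorem piK_le_of_paths {V : Type*} [Fintype V] {A : V → V → Prop} {k : ℕ} (L : List (List V))
    (hchain : ∀ p ∈ L, p.IsChain A) (hne : ∀ p ∈ L, p ≠ []) (hnd : L.flatten.Nodup) :
    piK A k + L.flatten.length ≤ (L.map fun p => min p.length k).sum + Fintype.card V := by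
  classical
  let R : List V := (Finset.univ \ L.flatten.toFinset).toList
  let M : List (List V) := L ++ R.map fun v => [v]
  have hMflat : M.flatten = L.flatten ++ R := by
    have h : ∀ l : List V, (l.map fun v => [v]).flatten = l := fun l => by
      induction l <;> simp_all
    simp [M, h]
  have hMne : ∀ p ∈ M, p ≠ [] := by
    intro p hp
    rcases List.mem_append.1 hp with hp | hp
    · exact hne p hp
    · obtain ⟨v, -, rfl⟩ := List.mem_map.1 hp
      simp
  have hMchain : ∀ p ∈ M, p.IsChain A := by
    intro p hp
    rcases List.mem_append.1 hp with hp | hp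
    · exact hchain p hp
    · obtain ⟨v, -, rfl⟩ := List.mem_map.1 hp
      simp
  have hMnd : M.flatten.Nodup := by
    rw [hMflat, List.nodup_append']
    refine ⟨hnd, Finset.nodup_toList _, ?_⟩
    intro v hv hv'
    simp only [R, Finset.mem_toList, Finset.mem_sdiff, List.mem_toFinset] at hv'
    exact hv'.2 hv
  have hpair := List.nodup_flatten.1 hMnd
  have hM : M.Nodup := by
    refine (List.Pairwise.and_mem.1 hpair.2).imp ?_
    rintro p q ⟨hp, -, hpq⟩ rfl
    obtain ⟨v, hv⟩ := List.exists_mem_of_ne_nil p (hMne p hp)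
    exact hpq hv hv
  have hpart : IsPathPartition A M.toFinset := by
    refine ⟨fun p hp => ?_, fun p hp q hq hpq v hv hv' => ?_, fun v => ?_⟩
    · rw [List.mem_toFinset] at hp
      exact ⟨⟨hpair.1 p hp, hMchain p hp⟩, hMne p hp⟩
    · rw [List.mem_toFinset] at hp hq
      have : Std.Symm (List.Disjoint (α := V)) := ⟨fun _ _ h => h.symm⟩
      exact hpair.2.forall hp hq hpq hv hv'
    · have : v ∈ M.flatten := by
        rw [hMflat, List.mem_append]
        by_cases h : v ∈ L.flatten
        · exact Or.inl h
        · right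
          simp only [R, Finset.mem_toList, Finset.mem_sdiff, List.mem_toFinset]
          exact ⟨Finset.mem_univ v, h⟩
      obtain ⟨p, hp, hv⟩ := List.mem_flatten.1 this
      exact ⟨p, List.mem_toFinset.2 hp, hv⟩
  have hle : piK A k ≤ kNorm k M.toFinset := Nat.sInf_le ⟨_, hpart, rfl⟩
  have hnorm : kNorm k M.toFinset ≤ (L.map fun p => min p.length k).sum + R.length := by
    rw [kNorm, List.sum_toFinset _ hM, List.map_append, List.sum_append, List.map_map]
    refine Nat.add_le_add_left ?_ _
    refine (List.sum_le_card_nsmul _ 1 ?_).trans (by simp)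
    simp
  have hR : R.length + L.flatten.length = Fintype.card V := by
    simp only [R, Finset.length_toList]
    rw [← List.toFinset_card_of_nodup hnd, Finset.card_sdiff_add_card_eq_card
      (Finset.subset_univ _), Finset.card_univ]
  omega

/-- The invariant of the construction of two interleaved paths along a zigzag-free path: `P` and `Q`
cover the initial segment `pref` and the `j` vertices `zs` of `Y`, while `T` is a set of `j`
vertices of `pref` forcing the directions of arcs to common neighbors. -/
structure IsInterleaving {V : Type*} (A : V → V → Prop) (Y : Finset V) (j : ℕ)
    (pref suf : List V) (T : Finset V) (zs P Q : List V) : Prop where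
  suf_ne : suf ≠ []
  card_T : T.card = j
  T_subset : ∀ t ∈ T, t ∈ pref
  arcs_of_adj : ∀ z ∈ Y, (∀ t ∈ T, DiAdj A z t) → ∀ t ∈ T, A t z
  not_arc_head : ∀ y ∈ Y, (∀ t ∈ T, A t y) → ∀ v ∈ suf.head?, ¬ A y v
  notMem_zs : ∀ y ∈ Y, (∀ t ∈ T, A t y) → y ∉ zs
  length_zs : zs.length = j
  zs_subset : ∀ z ∈ zs, z ∈ Y
  nodup_zs : zs.Nodup
  perm : (P ++ Q).Perm (pref ++ zs)
  chain_left : P.IsChain A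
  chain_right : Q.IsChain A
  extend_left : ∀ u ∈ P.getLast?, ∀ y ∈ Y, (∀ t ∈ T, A t y) → A u y
  extend_right : ∀ z ∈ Q.getLast?, ∀ v ∈ suf.head?, A z v

theorem ZigzagFree.not_arcs {V : Type*} {A : V → V → Prop} {Y : Finset V} {p : List V}
    (hz : ZigzagFree A Y p) {l₁ l₂ : List V} {u v y : V} (hp : p = l₁ ++ u :: v :: l₂)
    (hy : y ∈ Y) (huy : A u y) (hyv : A y v) : False := by
  subst hp
  have := (hz y hy).2.2 l₁.length (by simp)
  simp [huy, hyv] at this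

/-- Splitting a list at its first element satisfying a predicate. -/
theorem List.exists_eq_append_cons_first {α : Type*} (q : α → Prop) {l : List α}
    (h : ∃ x ∈ l, q x) : ∃ a x b, l = a ++ x :: b ∧ q x ∧ ∀ w ∈ a, ¬ q w := by
  induction l with
  | nil => simp at h
  | cons c l ih =>
    by_cases hc : q c
    · exact ⟨[], c, l, rfl, hc, by simp⟩
    · obtain ⟨x, hx, hqx⟩ := h
      have hxl : x ∈ l := by
        rcases List.mem_cons.1 hx with rfl | h
        · exact absurd hqx hc
        · exact h
      obtain ⟨a, x, b, rfl, hx, ha⟩ := ih ⟨x, hxl, hqx⟩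
      refine ⟨c :: a, x, b, rfl, hx, ?_⟩
      intro w hw
      rcases List.mem_cons.1 hw with rfl | h
      · exact hc
      · exact ha w h

/-- The interleaved paths can be extended as long as fewer than `k` vertices of `Y` are used. -/
theorem IsInterleaving.exists_succ {V : Type*} [DecidableEq V] {A : V → V → Prop}
    {Y : Finset V} {j k : ℕ} {pref suf : List V} {T : Finset V} {zs P Q : List V}
    (h : IsInterleaving A Y j pref suf T zs P Q) (hnd : (pref ++ suf).Nodup)
    (hchain : (pref ++ suf).IsChain A) (hz : ZigzagFree A Y (pref ++ suf))
    (hk : k ≤ (pref ++ suf).length) (hjk : j < k)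
    (htight : ∀ S ⊆ (pref ++ suf).toFinset, S.card = k → ∃ y ∈ Y, ∀ x ∈ S, DiAdj A y x) :
    ∃ pref' suf' T' zs' P' Q', pref ++ suf = pref' ++ suf' ∧
      IsInterleaving A Y (j + 1) pref' suf' T' zs' P' Q' := by
  obtain ⟨y₀, hy₀, hTy₀, hy₀l⟩ : ∃ y ∈ Y, (∀ t ∈ T, A t y) ∧ A y (suf.getLast h.suf_ne) := by
    obtain ⟨S, hTS, hSp, hS⟩ := Finset.exists_subsuperset_card_eq
      (s := insert (suf.getLast h.suf_ne) T) (t := (pref ++ suf).toFinset) (n := k)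
      (by
        intro t ht
        rcases Finset.mem_insert.1 ht with rfl | ht
        · simp
        · simp [h.T_subset t ht])
      ((Finset.card_insert_le _ _).trans (by rw [h.card_T]; exact hjk))
      (by rwa [List.toFinset_card_of_nodup hnd])
    obtain ⟨y, hy, hadj⟩ := htight S hSp hS
    refine ⟨y, hy, h.arcs_of_adj y hy fun t ht => hadj t (hTS (Finset.mem_insert_of_mem ht)), ?_⟩
    refine (hadj _ (hTS (Finset.mem_insert_self _ _))).resolve_right fun hbad => ?_
    refine (hz y hy).2.1 (by simp [h.suf_ne]) ?_
    rwa [List.getLast_append_of_right_ne_nil _ _ h.suf_ne]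
  obtain ⟨a, x, b, rfl, ⟨y, hy, hTy, hyx⟩, ha⟩ := List.exists_eq_append_cons_first
    (fun x => ∃ y ∈ Y, (∀ t ∈ T, A t y) ∧ A y x) (l := suf)
    ⟨_, List.getLast_mem h.suf_ne, y₀, hy₀, hTy₀, hy₀l⟩
  rcases List.eq_nil_or_concat' a with rfl | ⟨a', u, rfl⟩
  · exact absurd hyx (h.not_arc_head y hy hTy x (by simp))
  have hchain' : (pref ++ ((a' ++ [u]) ++ x :: b)).IsChain A := hchain
  have huT : u ∉ T := by
    intro hu
    have := h.T_subset u hu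
    simp [List.nodup_append] at hnd
    grind
  have hnot : ∀ z ∈ Y, (∀ t ∈ insert u T, A t z) → ¬ A z x := by
    intro z hz' hT hzx
    exact hz.not_arcs (l₁ := pref ++ a') (u := u) (v := x) (l₂ := b) (by simp) hz'
      (hT u (Finset.mem_insert_self _ _)) hzx
  have hyzs : y ∉ zs := h.notMem_zs y hy hTy
  refine ⟨pref ++ (a' ++ [u]), x :: b, insert u T, y :: zs, Q ++ (a' ++ [u]), P ++ [y],
    by simp, ?_⟩
  refine ⟨by simp, by rw [Finset.card_insert_of_notMem huT, h.card_T], ?_, ?_, ?_, ?_,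
    by simp [h.length_zs], ?_, ?_, ?_, ?_, ?_, ?_, ?_⟩
  · intro t ht
    rcases Finset.mem_insert.1 ht with rfl | ht
    · simp
    · simp [h.T_subset t ht]
  · intro z hz' hadj
    have hT := h.arcs_of_adj z hz' fun t ht => hadj t (Finset.mem_insert_of_mem ht)
    intro t ht
    rcases Finset.mem_insert.1 ht with rfl | ht
    · exact (hadj t (Finset.mem_insert_self _ _)).resolve_left fun hzt =>
        ha t (by simp) ⟨z, hz', hT, hzt⟩
    · exact hT t ht
  · intro z hz' hT v hv
    obtain rfl : x = v := by simpa using hv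
    exact hnot z hz' hT
  · intro z hz' hT hmem
    rcases List.mem_cons.1 hmem with rfl | hmem
    · exact hnot z hz' hT hyx
    · exact h.notMem_zs z hz' (fun t ht => hT t (Finset.mem_insert_of_mem ht)) hmem
  · intro z hz'
    rcases List.mem_cons.1 hz' with rfl | hz'
    · exact hy
    · exact h.zs_subset z hz'
  · exact List.nodup_cons.2 ⟨hyzs, h.nodup_zs⟩
  · rw [List.perm_iff_count]
    intro v
    have := List.perm_iff_count.1 h.perm v
    simp only [List.count_append, List.count_cons, List.count_nil] at this ⊢
    omega
  · refine h.chain_right.append (hchain'.right_of_append).left_of_append ?_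
    intro z hz' v hv
    refine h.extend_right z hz' v ?_
    rw [List.head?_append, Option.mem_def.1 hv]
    rfl
  · refine h.chain_left.append (List.isChain_singleton _) ?_
    intro u' hu' v hv
    obtain rfl : y = v := by simpa using hv
    exact h.extend_left u' hu' y hy hTy
  · intro u' hu' z hz' hT
    obtain rfl : u = u' := by simpa [← List.append_assoc] using hu'
    exact hT u (Finset.mem_insert_self _ _)
  · intro z hz' v hv
    obtain rfl : y = z := by simpa using hz'
    obtain rfl : x = v := by simpa using hv
    exact hyx

theorem exists_isInterleaving {V : Type*} [DecidableEq V] {A : V → V → Prop}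
    {Y : Finset V} {k : ℕ} {p : List V} (hne : p ≠ []) (hnd : p.Nodup)
    (hchain : p.IsChain A) (hz : ZigzagFree A Y p) (hk : k ≤ p.length)
    (htight : ∀ S ⊆ p.toFinset, S.card = k → ∃ y ∈ Y, ∀ x ∈ S, DiAdj A y x)
    (j : ℕ) (hj : j ≤ k) :
    ∃ pref suf T zs P Q, p = pref ++ suf ∧ IsInterleaving A Y j pref suf T zs P Q := by
  induction j with
  | zero =>
    refine ⟨[], p, ∅, [], [], [], rfl, ?_⟩
    refine ⟨hne, rfl, by simp, by simp, ?_, by simp, rfl, by simp, by simp, by simp, by simp,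
      by simp, by simp, by simp⟩
    intro y hy _ v hv
    rw [List.head?_eq_some_head hne] at hv
    obtain rfl : p.head hne = v := by simpa using hv
    exact (hz y hy).1 hne
  | succ j ih =>
    obtain ⟨pref, suf, T, zs, P, Q, rfl, h⟩ := ih (by omega)
    exact h.exists_succ hnd hchain hz hk hj htight

/-- Along a zigzag-free path, tightness yields two disjoint paths covering it together with
`k + 1` vertices of `Y`. -/
theorem ZigzagFree.exists_two_paths {V : Type*} [DecidableEq V] {A : V → V → Prop}
    {Y : Finset V} {k : ℕ} {p : List V} (hz : ZigzagFree A Y p) (hne : p ≠ []) (hnd : p.Nodup)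
    (hchain : p.IsChain A) (hk : k ≤ p.length) (hpY : ∀ v ∈ p, v ∉ Y)
    (htight : ∀ S ⊆ p.toFinset, S.card = k → ∃ y ∈ Y, ∀ x ∈ S, DiAdj A y x) :
    ∃ P Q : List V, P ≠ [] ∧ Q ≠ [] ∧ P.IsChain A ∧ Q.IsChain A ∧ (P ++ Q).Nodup ∧
      (P ++ Q).length = p.length + (k + 1) := by
  obtain ⟨pref, suf, T, zs, P, Q, rfl, h⟩ :=
    exists_isInterleaving hne hnd hchain hz hk htight k le_rfl
  obtain ⟨z, hzY, hadj⟩ := htight T (fun t ht => by simp [h.T_subset t ht]) h.card_T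
  have hT := h.arcs_of_adj z hzY hadj
  have hzzs := h.notMem_zs z hzY hT
  have hperm : ((P ++ [z]) ++ (Q ++ suf)).Perm ((pref ++ suf) ++ z :: zs) := by
    rw [List.perm_iff_count]
    intro v
    have := List.perm_iff_count.1 h.perm v
    simp only [List.count_append, List.count_cons, List.count_nil] at this ⊢
    omega
  refine ⟨P ++ [z], Q ++ suf, by simp, by simp [h.suf_ne], ?_, ?_, ?_, ?_⟩
  · refine h.chain_left.append (List.isChain_singleton _) ?_
    intro u hu v hv
    obtain rfl : z = v := by simpa using hv
    exact h.extend_left u hu z hzY hT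
  · exact h.chain_right.append hchain.right_of_append h.extend_right
  · rw [hperm.nodup_iff, List.nodup_append']
    refine ⟨hnd, List.nodup_cons.2 ⟨hzzs, h.nodup_zs⟩, ?_⟩
    intro v hv hv'
    refine hpY v hv ?_
    rcases List.mem_cons.1 hv' with rfl | hv'
    · exact hzY
    · exact h.zs_subset v hv'
  · rw [hperm.length_eq]
    simp [h.length_zs, Nat.add_assoc]

/-- A path that is not zigzag-free can be extended by a vertex of `Y`. -/
theorem exists_path_insert_of_not_zigzagFree {V : Type*} {A : V → V → Prop}
    {Y : Finset V} {p : List V} (hz : ¬ ZigzagFree A Y p) (hchain : p.IsChain A) :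
    ∃ y ∈ Y, ∃ q : List V, q.Perm (y :: p) ∧ q.IsChain A := by
  unfold ZigzagFree at hz
  push Not at hz
  obtain ⟨y, hy, hz⟩ := hz
  refine ⟨y, hy, ?_⟩
  by_cases h1 : ∀ h : p ≠ [], ¬ A y (p.head h)
  · by_cases h2 : ∀ h : p ≠ [], ¬ A (p.getLast h) y
    · obtain ⟨i, hi, h3, h4⟩ := hz h1 h2
      refine ⟨p.take (i + 1) ++ y :: p.drop (i + 1), ?_, ?_⟩
      · exact List.perm_middle.trans (by rw [List.take_append_drop])
      · refine (hchain.take _).append ?_ ?_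
        · rw [List.drop_eq_getElem_cons hi, List.isChain_cons_cons]
          refine ⟨h4, ?_⟩
          rw [← List.drop_eq_getElem_cons hi]
          exact hchain.drop _
        · intro u hu v hv
          obtain rfl : y = v := by simpa using hv
          rw [List.take_succ_eq_append_getElem (by omega), List.getLast?_concat] at hu
          obtain rfl : p[i] = u := by simpa using hu
          exact h3
    · push Not at h2
      obtain ⟨h, h2⟩ := h2
      refine ⟨p ++ [y], List.perm_append_singleton _ _,
        hchain.append (List.isChain_singleton _) ?_⟩
      intro u hu v hv
      obtain rfl : y = v := by simpa using hv
      rw [List.getLast?_eq_some_getLast h] at hu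
      obtain rfl : p.getLast h = u := by simpa using hu
      exact h2
  · push Not at h1
    obtain ⟨h, h1⟩ := h1
    refine ⟨y :: p, List.Perm.refl _, ?_⟩
    refine (List.isChain_singleton y).append hchain ?_
    intro u hu v hv
    obtain rfl : y = u := by simpa using hu
    rw [List.head?_eq_some_head h] at hv
    obtain rfl : p.head h = v := by simpa using hv
    exact h1

/-- A set of fewer than `k` vertices and a stable set can be colored with `k` colors. -/
theorem card_add_card_le_alphaK_of_card_lt {V : Type*} [Fintype V] [DecidableEq V]
    {A : V → V → Prop} {k : ℕ} {S Y : Finset V} (hSY : Disjoint S Y)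
    (hY : IsStableSet A (Y : Set V)) (hS : S.card < k) : S.card + Y.card ≤ alphaK A k := by
  let c : Fin k := ⟨S.card, hS⟩
  refine card_add_card_le_alphaK hSY hY
    (fun v => if h : v ∈ S then ⟨S.equivFin ⟨v, h⟩, (S.equivFin ⟨v, h⟩).2.trans hS⟩ else c)
    (fun _ => c) ?_ ?_
  · intro u hu v hv huv
    have hu' : u ∈ S := hu
    have hv' : v ∈ S := hv
    simp only [hu', hv', dif_pos, Fin.mk.injEq] at huv
    simpa using S.equivFin.injective (Fin.ext huv)
  · intro y _ s hs hsy
    simp only [hs, dif_pos, c, Fin.mk.injEq] at hsy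
    exact absurd hsy (S.equivFin ⟨s, hs⟩).2.ne

/-- `k` vertices without common neighbor in a stable set `Y` can be colored with `Y`. -/
theorem card_add_card_le_alphaK_of_exists_not_adj {V : Type*} [Fintype V] [DecidableEq V]
    {A : V → V → Prop} {k : ℕ} (hk : 0 < k) {S Y : Finset V} (hSY : Disjoint S Y)
    (hY : IsStableSet A (Y : Set V)) (hS : S.card = k)
    (hadj : ∀ y ∈ Y, ∃ x ∈ S, ¬ DiAdj A y x) : S.card + Y.card ≤ alphaK A k := by
  classical
  choose! x hxS hx using hadj
  let e : V → Fin k := fun v =>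
    if h : v ∈ S then (S.equivFinOfCardEq hS) ⟨v, h⟩ else ⟨0, hk⟩
  have he : Set.InjOn e S := by
    intro u hu v hv huv
    have hu' : u ∈ S := hu
    have hv' : v ∈ S := hv
    simpa [e, hu', hv'] using huv
  refine card_add_card_le_alphaK hSY hY e (fun y => e (x y)) he ?_
  intro y hy s hs hsy
  rw [he hs (hxS y hy) hsy]
  exact hx y hy

/-- Linial's Conjecture holds for spine digraphs: if `D[X,Y]` is a
spine digraph and `k` a positive integer, then `π_k(D) ≤ α_k(D)`. -/
theorem spine_linial {V : Type*} [Fintype V] [DecidableEq V]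
    (A : V → V → Prop) (hloopless : Irreflexive A)
    (X Y : Finset V) (hspine : IsSpinePartition A X Y)
    (k : ℕ) (hk : 0 < k) :
    piK A k ≤ alphaK A k := by
  obtain ⟨hXY, ⟨p, ⟨hnd, hchain⟩, hp⟩, hY⟩ := hspine
  have hchain : p.IsChain A := hchain
  have hdis : Disjoint X Y := Finset.disjoint_left.2 fun v hv => (hXY v).1 hv
  have hpX : p.toFinset = X := by
    ext v
    rw [List.mem_toFinset, hp]
  have hlen : p.length = X.card := by rw [← hpX, List.toFinset_card_of_nodup hnd]
  have hcard : X.card + Y.card = Fintype.card V := by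
    rw [← Finset.card_union_of_disjoint hdis, ← Finset.card_univ]
    congr 1
    ext v
    have := hXY v
    simp only [Finset.mem_union, Finset.mem_univ, iff_true]
    tauto
  by_cases hXk : X.card < k
  · have h1 := card_add_card_le_alphaK_of_card_lt hdis hY hXk
    have h2 := piK_le_of_paths (A := A) (k := k) [] (by simp) (by simp) (by simp)
    simp only [List.flatten_nil, List.length_nil, List.map_nil, List.sum_nil] at h2
    omega
  push Not at hXk
  have hne : p ≠ [] := by
    rintro rfl
    simp only [List.length_nil] at hlen
    omega
  by_cases hloose : ∃ S ⊆ X, S.card = k ∧ ∀ y ∈ Y, ∃ x ∈ S, ¬ DiAdj A y x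
  · obtain ⟨S, hSX, hS, hadj⟩ := hloose
    have h1 := card_add_card_le_alphaK_of_exists_not_adj hk
      (Finset.disjoint_of_subset_left hSX hdis) hY hS hadj
    have h2 := piK_le_of_paths (A := A) (k := k) [p] (by simpa using hchain) (by simpa using hne)
      (by simpa using hnd)
    simp only [List.flatten_singleton, List.map_singleton, List.sum_singleton] at h2
    omega
  push Not at hloose
  obtain ⟨S, hSX, hS⟩ := Finset.exists_subset_card_eq (s := X) (n := k - 1) (by omega)
  have h1 := card_add_card_le_alphaK_of_card_lt (k := k)
    (Finset.disjoint_of_subset_left hSX hdis) hY (by omega)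
  by_cases hz : ZigzagFree A Y p
  · obtain ⟨P, Q, hP, hQ, hPc, hQc, hPQ, hPQl⟩ := hz.exists_two_paths (k := k) hne hnd hchain
      (by omega) (fun v hv => (hXY v).1 ((hp v).1 hv)) (by rwa [hpX])
    have h2 := piK_le_of_paths (A := A) (k := k) [P, Q] (by simp [hPc, hQc]) (by simp [hP, hQ])
      (by simpa using hPQ)
    simp only [List.flatten_cons, List.flatten_nil, List.append_nil, List.map_cons, List.map_nil,
      List.sum_cons, List.sum_nil] at h2
    omega
  · obtain ⟨y, hy, q, hq, hqc⟩ := exists_path_insert_of_not_zigzagFree hz hchain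
    have hyp : y ∉ p := fun h => (hXY y).1 ((hp y).1 h) hy
    have hqne : q ≠ [] := by
      rintro rfl
      simp at hq
    have h2 := piK_le_of_paths (A := A) (k := k) [q] (by simpa using hqc) (by simpa using hqne)
      (by simpa [hq.nodup_iff] using ⟨hyp, hnd⟩)
    simp only [List.flatten_singleton, List.map_singleton, List.sum_singleton] at h2
    have h3 := hq.length_eq
    simp only [List.length_cons] at h3
    omega
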